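/- Let f(y₁, y₂) = ind(y₂² − y₁² − 1) and let (P₁f)(y₂) = ∫_ℝ f(y₁, y₂) ρ(y₁) dy₁. Then (P₁f)(y₂) = 0 for y₂ ∈ [−1, 1], and (P₁f)(y₂) = Φ(√(y₂² − 1)) − Φ(−√(y₂² − 1)) for |y₂| > 1. Moreover (P₁f)(y₂)/√(y₂² − 1) → 2ρ(0) as y₂ → 1⁺ (and, by the evenness of P₁f, as y₂ → (−1)⁻), so P₁f has square-root singularities at y₂ = ±1. -/

import Mathlib

open Filter Topology Set

/-- The standard normal density. -/
noncomputable def ρ (y : ℝ) : ℝ := Real.exp (-y ^ 2 / 2) / Real.sqrt (2 * Real.pi)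

/-- The standard normal cumulative distribution function. -/
noncomputable def Φ (x : ℝ) : ℝ := ∫ y in Set.Iic x, ρ y

/-- The indicator `ind u = 1` if `u > 0` and `0` otherwise. -/
noncomputable def ind (u : ℝ) : ℝ := if 0 < u then 1 else 0

open MeasureTheory in
lemma rho_cont : Continuous ρ := by
  unfold ρ; fun_prop

open MeasureTheory in
lemma rho_int : Integrable ρ := by
  have h := (integrable_exp_neg_mul_sq (b := 1 / 2) (by norm_num)).div_const
    (Real.sqrt (2 * Real.pi))
  refine h.congr (Eventually.of_forall fun y => ?_)
  simp only [ρ]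
  congr 2
  ring

open MeasureTheory in
lemma pre_eq (y : ℝ) (hy : 1 < |y|) :
    (∫ t : ℝ, ind (y ^ 2 - t ^ 2 - 1) * ρ t) =
      ∫ t in (-Real.sqrt (y ^ 2 - 1))..(Real.sqrt (y ^ 2 - 1)), ρ t := by
  have h0 : 0 ≤ Real.sqrt (y ^ 2 - 1) := Real.sqrt_nonneg _
  rw [intervalIntegral.integral_of_le (by linarith), integral_Ioc_eq_integral_Ioo,
    ← integral_indicator measurableSet_Ioo]
  congr 1
  ext t
  have key : 0 < y ^ 2 - t ^ 2 - 1 ↔ t ∈ Ioo (-Real.sqrt (y ^ 2 - 1)) (Real.sqrt (y ^ 2 - 1)) := by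
    rw [mem_Ioo, ← abs_lt, Real.lt_sqrt (abs_nonneg t), sq_abs]
    constructor <;> intro h <;> linarith
  by_cases h : 0 < y ^ 2 - t ^ 2 - 1
  · rw [indicator_of_mem (key.1 h)]; simp [ind, h]
  · rw [indicator_of_notMem (fun h' => h (key.2 h'))]; simp [ind, h]

lemma slope_lim : Tendsto (fun s : ℝ => (∫ t in (-s)..s, ρ t) / s) (𝓝[≠] 0) (𝓝 (2 * ρ 0)) := by
  have hF : ∀ x, HasDerivAt (fun s : ℝ => ∫ t in (0 : ℝ)..s, ρ t) (ρ x) x := fun x =>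
    rho_cont.integral_hasStrictDerivAt 0 x |>.hasDerivAt
  have h1 : HasDerivAt (fun s : ℝ => ∫ t in (0 : ℝ)..(-s), ρ t) (ρ (-0) * (-1)) 0 :=
    (hF (-0)).comp (0 : ℝ) (hasDerivAt_neg (0 : ℝ))
  have h2 := (hF 0).sub h1
  rw [hasDerivAt_iff_tendsto_slope] at h2
  have e : ρ 0 - ρ (-0) * (-1) = 2 * ρ 0 := by rw [neg_zero]; ring
  rw [e] at h2
  refine h2.congr fun s => ?_
  have : (∫ t in (0 : ℝ)..s, ρ t) - (∫ t in (0 : ℝ)..(-s), ρ t) = ∫ t in (-s)..s, ρ t :=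
    intervalIntegral.integral_interval_sub_left (rho_cont.intervalIntegrable _ _)
      (rho_cont.intervalIntegrable _ _)
  simp [slope_def_field, this]

lemma lim_aux (l : Filter ℝ) (a : ℝ) (ha : a ^ 2 = 1) (hl : l ≤ 𝓝 a)
    (h : ∀ᶠ y in l, 1 < |y|) :
    Tendsto (fun y₂ : ℝ =>
        (∫ y₁ : ℝ, ind (y₂ ^ 2 - y₁ ^ 2 - 1) * ρ y₁) / Real.sqrt (y₂ ^ 2 - 1))
      l (𝓝 (2 * ρ 0)) := by
  have hs : Tendsto (fun y : ℝ => Real.sqrt (y ^ 2 - 1)) l (𝓝[≠] 0) := by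
    refine tendsto_nhdsWithin_iff.2 ⟨?_, ?_⟩
    · have hc : Continuous (fun y : ℝ => Real.sqrt (y ^ 2 - 1)) := by fun_prop
      have := (hc.tendsto a).mono_left hl
      simpa [ha] using this
    · filter_upwards [h] with y hy
      have : 1 < y ^ 2 := (one_lt_sq_iff_one_lt_abs y).2 hy
      exact (Real.sqrt_pos.2 (by linarith)).ne'
  refine (slope_lim.comp hs).congr' ?_
  filter_upwards [h] with y hy
  simp only [Function.comp]
  rw [pre_eq y hy]

/-- **Example 2 of the paper (hyperbola).**  For `f(y₁,y₂) = ind(y₂² − y₁² − 1)` and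
`(P₁ f)(y₂) = ∫_ℝ f(y₁,y₂) ρ(y₁) dy₁`, one has `(P₁ f)(y₂) = 0` for `y₂ ∈ [−1,1]` and
`(P₁ f)(y₂) = Φ(√(y₂²−1)) − Φ(−√(y₂²−1))` for `|y₂| > 1`.  Moreover
`(P₁ f)(y₂)/√(y₂²−1) → 2ρ(0)` as `y₂ → 1⁺` and as `y₂ → (−1)⁻`, square-root singularities
at `y₂ = ±1`. -/
theorem preintegration_hyperbola :
    (∀ y₂ ∈ Set.Icc (-1 : ℝ) 1, (∫ y₁ : ℝ, ind (y₂ ^ 2 - y₁ ^ 2 - 1) * ρ y₁) = 0) ∧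
    (∀ y₂ : ℝ, 1 < |y₂| →
      (∫ y₁ : ℝ, ind (y₂ ^ 2 - y₁ ^ 2 - 1) * ρ y₁) =
        Φ (Real.sqrt (y₂ ^ 2 - 1)) - Φ (-Real.sqrt (y₂ ^ 2 - 1))) ∧
    Tendsto (fun y₂ : ℝ =>
        (∫ y₁ : ℝ, ind (y₂ ^ 2 - y₁ ^ 2 - 1) * ρ y₁) / Real.sqrt (y₂ ^ 2 - 1))
      (𝓝[>] 1) (𝓝 (2 * ρ 0)) ∧
    Tendsto (fun y₂ : ℝ =>
        (∫ y₁ : ℝ, ind (y₂ ^ 2 - y₁ ^ 2 - 1) * ρ y₁) / Real.sqrt (y₂ ^ 2 - 1))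
      (𝓝[<] (-1)) (𝓝 (2 * ρ 0)) := by
  refine ⟨?_, ?_, ?_, ?_⟩
  · intro y hy
    have : ∀ t : ℝ, ind (y ^ 2 - t ^ 2 - 1) * ρ t = 0 := by
      intro t
      have : ¬ 0 < y ^ 2 - t ^ 2 - 1 := by
        have := hy.1
        have := hy.2
        nlinarith [sq_nonneg t]
      simp [ind, this]
    simp [this]
  · intro y hy
    rw [pre_eq y hy]
    exact (intervalIntegral.integral_Iic_sub_Iic rho_int.integrableOn rho_int.integrableOn).symm
  · refine lim_aux _ 1 (by norm_num) nhdsWithin_le_nhds ?_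
    filter_upwards [self_mem_nhdsWithin] with y hy
    exact lt_of_lt_of_le hy (le_abs_self y)
  · refine lim_aux _ (-1) (by norm_num) nhdsWithin_le_nhds ?_
    filter_upwards [self_mem_nhdsWithin] with y hy
    have hy' : y < -1 := hy
    exact lt_of_lt_of_le (by linarith) (neg_le_abs y)
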